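/- For every w ∈ S_n, the cocharge of the evacuated recording tableau satisfies cc(Q̃(w)) = Σ_{i ∈ Dsl(w)} i (the major index of w). Moreover, for w_+ ∈ S_{n+1} acting as w on {1,…,n} and fixing n+1, one has Dsl(w_+) = Dsl(w), and hence cc(Q̃(w_+)) = cc(Q̃(w)). -/

import Mathlib

open MvPolynomial

noncomputable section

namespace HigherSpecht

open scoped Classical

/-- A tableau: a filling of the plane (row, column), `0`-indexed, with `0` outside the diagram. -/
abbrev Tab := ℕ × ℕ → ℕ

/-- A permutation of `ℕ` represents an element of `Sₙ` (acting on `{1, …, n}`)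
when it fixes `0` and everything above `n`. -/
def SuppIn (n : ℕ) (w : Equiv.Perm ℕ) : Prop := ∀ i, i = 0 ∨ n < i → w i = i

/-- Descending locations of a permutation (one-line notation `w 1, …, w n`). -/
def DslSet (n : ℕ) (w : Equiv.Perm ℕ) : Finset ℕ :=
  (Finset.Ioo 0 n).filter fun i => w (i + 1) < w i

/-- Ascending locations of a permutation. -/
def AslSet (n : ℕ) (w : Equiv.Perm ℕ) : Finset ℕ :=
  (Finset.Ioo 0 n).filter fun i => w i < w (i + 1)

/-- The row in which the entry `i` shows up in a tableau. -/
def rowIdx (T : Tab) (i : ℕ) : ℕ := sInf {r | ∃ c, T (r, c) = i}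

/-- The column in which the entry `i` shows up in a tableau. -/
def colIdx (T : Tab) (i : ℕ) : ℕ := sInf {c | T (rowIdx T i, c) = i}

/-- The box containing the entry `i`. -/
def posOf (T : Tab) (i : ℕ) : ℕ × ℕ := (rowIdx T i, colIdx T i)

/-- Descending indices of a (standard) tableau: `i` with the row of `i+1` strictly below
the row of `i`. -/
def DsiSet (n : ℕ) (T : Tab) : Finset ℕ :=
  (Finset.Ioo 0 n).filter fun i => rowIdx T i < rowIdx T (i + 1)

/-- `Dsi^c`, the complemented descent set `{n - i | i ∈ Dsi}`. -/
def Dsic (n : ℕ) (T : Tab) : Finset ℕ := (DsiSet n T).image fun i => n - i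

/-- The entry of `ct_J(S)` at a box `c`: the number of elements of `J` smaller than the
entry of `S` at `c`. -/
def ctEntry (T : Tab) (J : Finset ℕ) (c : ℕ × ℕ) : ℕ := (J.filter fun j => j < T c).card

/-- The cocharge tableau `ct(S)` of a standard tableau. -/
def ctTab (n : ℕ) (T : Tab) : Tab := fun c => ctEntry T (DsiSet n T) c

/-- The (total) cocharge `cc(S)`: the sum of the entries of `ct(S)`. -/
def ccStat (n : ℕ) (T : Tab) : ℕ :=
  ∑ i ∈ Finset.Icc 1 n, ctEntry T (DsiSet n T) (posOf T i)

/-- `T` is a bijective filling of the given set of cells by `1, …, n` (`n` the number of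
cells), with `0` outside. -/
def IsFillingF (cells : Finset (ℕ × ℕ)) (T : Tab) : Prop :=
  (∀ c, c ∉ cells → T c = 0) ∧ Set.BijOn T ↑cells (Set.Icc 1 cells.card)

/-- A bijective filling of a Young diagram. -/
def IsFilling (μ : YoungDiagram) (T : Tab) : Prop := IsFillingF μ.cells T

/-- A standard Young tableau of shape `μ`: entries strictly increase along rows and columns. -/
def IsStandard (μ : YoungDiagram) (T : Tab) : Prop :=
  IsFilling μ T ∧ ∀ c₁ ∈ μ.cells, ∀ c₂ ∈ μ.cells,
    c₁ ≠ c₂ → c₁.1 ≤ c₂.1 → c₁.2 ≤ c₂.2 → T c₁ < T c₂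

/-! ### Robinson–Schensted -/

/-- Row insertion: insert `x` into a row, returning the new row and the bumped entry. -/
def rowInsert : ℕ → List ℕ → List ℕ × Option ℕ
  | x, [] => ([x], none)
  | x, y :: ys =>
    if x < y then (x :: ys, some y)
    else
      let p := rowInsert x ys
      (y :: p.1, p.2)

/-- Insertion of an entry into a tableau, given as a list of rows. -/
def tabInsert : List (List ℕ) → ℕ → List (List ℕ)
  | [], x => [[x]]
  | r :: rs, x =>
    match rowInsert x r with
    | (r', none) => r' :: rs
    | (r', some y) => r' :: tabInsert rs y

/-- One-line notation of `w ∈ Sₙ`. -/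
def oneLine (n : ℕ) (w : Equiv.Perm ℕ) : List ℕ := (List.range n).map fun i => w (i + 1)

/-- The insertion tableau of the first `m` letters of `w`, as a list of rows. -/
def PtabListPart (n : ℕ) (w : Equiv.Perm ℕ) (m : ℕ) : List (List ℕ) :=
  ((oneLine n w).take m).foldl tabInsert []

/-- Entry of a list-of-rows tableau at a (0-indexed) cell. -/
def listEntry (t : List (List ℕ)) (c : ℕ × ℕ) : ℕ := (t.getD c.1 []).getD c.2 0

/-- The Robinson–Schensted insertion tableau `P(w)`. -/
def Ptab (n : ℕ) (w : Equiv.Perm ℕ) : Tab := fun c => listEntry (PtabListPart n w n) c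

/-- The Robinson–Schensted recording tableau `Q(w)`: the entry of a cell is the step at
which the cell is added to the shape. -/
def Qtab (n : ℕ) (w : Equiv.Perm ℕ) : Tab := fun c =>
  sInf {m | listEntry (PtabListPart n w m) c ≠ 0}

/-! ### Schützenberger evacuation -/

/-- One step of a jeu de taquin slide into the hole at `c`. -/
def slideOnce (T : Tab) (c : ℕ × ℕ) : Tab × (ℕ × ℕ) :=
  let rc : ℕ × ℕ := (c.1, c.2 + 1)
  let dc : ℕ × ℕ := (c.1 + 1, c.2)
  if T rc = 0 ∧ T dc = 0 then (T, c)
  else if T dc = 0 ∨ (T rc ≠ 0 ∧ T rc < T dc) then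
    (Function.update (Function.update T c (T rc)) rc 0, rc)
  else
    (Function.update (Function.update T c (T dc)) dc 0, dc)

/-- Jeu de taquin slide (with fuel). -/
def slide : ℕ → Tab → ℕ × ℕ → Tab × (ℕ × ℕ)
  | 0, T, c => (T, c)
  | k + 1, T, c =>
    let p := slideOnce T c
    if p.2 = c then (T, c) else slide k p.1 p.2

/-- The Schützenberger evacuation: repeatedly delete the minimal entry, slide into the hole,
decrement the remaining entries, and record the vacated cell. -/
def evacAux : ℕ → Tab → Tab
  | 0, _ => fun _ => 0
  | m + 1, T =>
    let c0 := posOf T 1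
    let p := slide (m + 1) (Function.update T c0 0) c0
    Function.update (evacAux m fun c => p.1 c - 1) p.2 (m + 1)

/-- The evacuation tableau `ev S` of a standard tableau with `n` boxes. -/
def evac (n : ℕ) (T : Tab) : Tab := evacAux n T

/-- `Q̃(w) := ev (Q w)`. -/
def Qt (n : ℕ) (w : Equiv.Perm ℕ) : Tab := evac n (Qtab n w)

/-! ### Row and column groups, higher Specht polynomials -/

/-- The identification of `Fin n` with `{1, …, n} ⊆ ℕ`. -/
def finShift (n : ℕ) : Fin n ≃ {i : ℕ // 1 ≤ i ∧ i ≤ n} where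
  toFun j := ⟨(j : ℕ) + 1, by have := j.isLt; omega⟩
  invFun i := ⟨(i : ℕ) - 1, by have := i.2; omega⟩
  left_inv j := by apply Fin.ext; simp
  right_inv i := by apply Subtype.ext; have := i.2; simp; omega

/-- Embedding of the permutations of `Fin n` into permutations of `ℕ` (acting on `{1, …, n}`). -/
def embedPerm (n : ℕ) (σ : Equiv.Perm (Fin n)) : Equiv.Perm ℕ :=
  σ.extendDomain (finShift n)

/-- The row group `R(T)` of a filling, as a finset of permutations of `Fin n`. -/
def rowFinset (n : ℕ) (T : Tab) : Finset (Equiv.Perm (Fin n)) :=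
  Finset.univ.filter fun τ => ∀ i ∈ Finset.Icc 1 n, rowIdx T (embedPerm n τ i) = rowIdx T i

/-- The column group `C(T)` of a filling, as a finset of permutations of `Fin n`. -/
def colFinset (n : ℕ) (T : Tab) : Finset (Equiv.Perm (Fin n)) :=
  Finset.univ.filter fun σ => ∀ i ∈ Finset.Icc 1 n, colIdx T (embedPerm n σ i) = colIdx T i

/-- The row group `R(T)` as a set of permutations of `ℕ`. -/
def rowGroupSet (n : ℕ) (T : Tab) : Set (Equiv.Perm ℕ) :=
  {w | SuppIn n w ∧ ∀ i ∈ Finset.Icc 1 n, rowIdx T (w i) = rowIdx T i}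

/-- The column group `C(T)` as a set of permutations of `ℕ`. -/
def colGroupSet (n : ℕ) (T : Tab) : Set (Equiv.Perm ℕ) :=
  {w | SuppIn n w ∧ ∀ i ∈ Finset.Icc 1 n, colIdx T (w i) = colIdx T i}

/-- The Young symmetrizer `ε_T = Σ_{σ ∈ C(T)} Σ_{τ ∈ R(T)} sgn(σ) σ τ` acting on polynomials
(permutations acting by permuting the variables). -/
def epsAct (n : ℕ) (T : Tab) (p : MvPolynomial ℕ ℚ) : MvPolynomial ℕ ℚ :=
  ∑ σ ∈ colFinset n T, ∑ τ ∈ rowFinset n T,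
    (Equiv.Perm.sign σ : ℤ) • rename (⇑(embedPerm n σ * embedPerm n τ)) p

/-- The monomial `p_T^S = Π_i x_i^{h_i}`, where `h_i` is the entry of `ct S` in the box of
`T` containing `i`. -/
def pTS (n : ℕ) (T S : Tab) : MvPolynomial ℕ ℚ :=
  ∏ i ∈ Finset.Icc 1 n, X i ^ ctEntry S (DsiSet n S) (posOf T i)

/-- `s_T^S`: the order of the stabilizer of `p_T^S` in `R(T)`. -/
def sTS (n : ℕ) (T S : Tab) : ℕ :=
  ((rowFinset n T).filter fun τ =>
    rename (⇑(embedPerm n τ)) (pTS n T S) = pTS n T S).card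

/-- The higher Specht polynomial `F_T^S := ε_T p_T^S / s_T^S`. -/
def FTS (n : ℕ) (T S : Tab) : MvPolynomial ℕ ℚ :=
  ((sTS n T S : ℚ)⁻¹) • epsAct n T (pTS n T S)

/-- The higher Specht polynomial `F_w := F_{P(w)}^{Q̃(w)}` of a permutation. -/
def Fw (n : ℕ) (w : Equiv.Perm ℕ) : MvPolynomial ℕ ℚ := FTS n (Ptab n w) (Qt n w)

/-- The elementary symmetric polynomial `e_r` in the variables `x_1, …, x_n`. -/
def esym (n r : ℕ) : MvPolynomial ℕ ℚ :=
  ∑ s ∈ (Finset.Icc 1 n).powersetCard r, ∏ i ∈ s, X i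

/-- The representation `V^S`: the span of the higher Specht polynomials `F_T^S` over all
bijective fillings `T` of the given cells. -/
def VS (n : ℕ) (cells : Finset (ℕ × ℕ)) (S : Tab) : Submodule ℚ (MvPolynomial ℕ ℚ) :=
  Submodule.span ℚ {p | ∃ T : Tab, IsFillingF cells T ∧ p = FTS n T S}

/-- Multiplication of a subspace of polynomials by a fixed polynomial. -/
def polyMul (q : MvPolynomial ℕ ℚ) (V : Submodule ℚ (MvPolynomial ℕ ℚ)) :
    Submodule ℚ (MvPolynomial ℕ ℚ) :=
  Submodule.map (LinearMap.mulLeft ℚ q) V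

/-- The symmetric multiplier `Π_r e_r^{h_r}`. -/
def eProd (n : ℕ) (h : ℕ → ℕ) : MvPolynomial ℕ ℚ := ∏ r ∈ Finset.Icc 1 n, esym n r ^ h r

/-- `V^S_h := (Π_r e_r^{h_r}) V^S`. -/
def VSh (n : ℕ) (cells : Finset (ℕ × ℕ)) (S : Tab) (h : ℕ → ℕ) :
    Submodule ℚ (MvPolynomial ℕ ℚ) :=
  polyMul (eProd n h) (VS n cells S)

/-! ### The representations `R_{n,I}` -/

/-- For `i ∈ I`, `r_i := #{j ∈ {1,…,n-1} \ I : j < i}`. -/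
def rIdxI (n : ℕ) (I : Finset ℕ) (i : ℕ) : ℕ :=
  ((Finset.Ioo 0 n \ I).filter fun j => j < i).card

/-- The vector `h^S_I`, whose `r`-th entry (for `r ≥ 1`) is `#{i ∈ I \ Dsi^c(S) : r_i = r}`. -/
def hSI (n : ℕ) (I : Finset ℕ) (S : Tab) : ℕ → ℕ := fun r =>
  if 1 ≤ r then ((I \ Dsic n S).filter fun i => rIdxI n I i = r).card else 0

/-- The indicator vector `h(I,S)` of the set `I \ Dsi^c(S)`. -/
def hInd (n : ℕ) (I : Finset ℕ) (S : Tab) : ℕ → ℕ := fun r =>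
  if r ∈ I \ Dsic n S then 1 else 0

/-- `F_{w,I} := F_w · Π_{i ∈ I \ Dsl(w)} e_{r_i}`. -/
def FwI (n : ℕ) (I : Finset ℕ) (w : Equiv.Perm ℕ) : MvPolynomial ℕ ℚ :=
  Fw n w * ∏ i ∈ I \ DslSet n w, esym n (rIdxI n I i)

/-- The homogeneous version `F^hom_{w,I} := F_w · Π_{i ∈ I \ Dsl(w)} e_i`. -/
def FwIhom (n : ℕ) (I : Finset ℕ) (w : Equiv.Perm ℕ) : MvPolynomial ℕ ℚ :=
  Fw n w * ∏ i ∈ I \ DslSet n w, esym n i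

/-- The representation `R_{n,I}`: span of the `F_{w,I}` over `w` with `Dsl(w) ⊆ I`. -/
def RnI (n : ℕ) (I : Finset ℕ) : Submodule ℚ (MvPolynomial ℕ ℚ) :=
  Submodule.span ℚ {p | ∃ w : Equiv.Perm ℕ, SuppIn n w ∧ DslSet n w ⊆ I ∧ p = FwI n I w}

/-- The homogeneous representation `R^hom_{n,I}`. -/
def RnIhom (n : ℕ) (I : Finset ℕ) : Submodule ℚ (MvPolynomial ℕ ℚ) :=
  Submodule.span ℚ {p | ∃ w : Equiv.Perm ℕ, SuppIn n w ∧ DslSet n w ⊆ I ∧ p = FwIhom n I w}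

/-- The index type for the decomposition of `R_{n,I}`: pairs of a partition `λ ⊢ n` and a
standard Young tableau `S` of shape `λ` with `Dsi^c(S) ⊆ I`. -/
def SIdx (n : ℕ) (I : Finset ℕ) : Type :=
  {q : YoungDiagram × Tab // q.1.cells.card = n ∧ IsStandard q.1 q.2 ∧ Dsic n q.2 ⊆ I}

/-! ### Ordered set partitions -/

/-- The cumulative values `j_h` attached to a subset `I ⊆ {1,…,n-1}` (`j_0 = 0`,
`j_h` the `h`-th smallest element, `j_{|I|+1} = n`). -/
def jval (n : ℕ) (I : Finset ℕ) (h : ℕ) : ℕ :=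
  if h = 0 then 0 else if h ≤ I.card then (I.sort (· ≤ ·)).getD (h - 1) 0 else n

/-- The composition `comp_n I`, as a function of the index `0 ≤ h ≤ |I|`. -/
def compFun (n : ℕ) (I : Finset ℕ) (h : ℕ) : ℕ := jval n I (h + 1) - jval n I h

/-- The set `OP_{n,I}` of ordered set partitions of `{1,…,n}` into `|I| + 1` blocks whose
sizes are given by `comp_n I` (blocks indexed by `ℕ`, empty from index `|I| + 1` on). -/
def OPset (n : ℕ) (I : Finset ℕ) : Set (ℕ → Finset ℕ) :=
  {B | (∀ h, I.card + 1 ≤ h → B h = ∅) ∧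
       (∀ h₁ h₂, h₁ ≠ h₂ → Disjoint (B h₁) (B h₂)) ∧
       (∀ h ≤ I.card, (B h).card = compFun n I h) ∧
       Finset.Icc 1 n = (Finset.range (I.card + 1)).biUnion B}

/-- The natural action of a permutation on an ordered set partition. -/
def permOP (w : Equiv.Perm ℕ) (B : ℕ → Finset ℕ) : ℕ → Finset ℕ := fun h => (B h).image w

/-! ### The quotient `R_{n,k}` -/

/-- Elementary symmetric polynomials in `Fin n` variables. -/
def esymFin (n r : ℕ) : MvPolynomial (Fin n) ℚ :=
  ∑ s ∈ (Finset.univ : Finset (Fin n)).powersetCard r, ∏ i ∈ s, X i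

/-- The ideal defining `R_{n,k}`: generated by `x_i^k` and `e_r`, `n-k+1 ≤ r ≤ n`. -/
def Jnk (n k : ℕ) : Ideal (MvPolynomial (Fin n) ℚ) :=
  Ideal.span ((Set.range fun i : Fin n => (X i : MvPolynomial (Fin n) ℚ) ^ k) ∪
    {p | ∃ r, n - k + 1 ≤ r ∧ r ≤ n ∧ p = esymFin n r})

/-- The map sending `x_i` (for `1 ≤ i ≤ n`) to the corresponding variable of
`ℚ[x_1, …, x_n]`, and all other variables to `0`. -/
def toFin (n : ℕ) : MvPolynomial ℕ ℚ →ₐ[ℚ] MvPolynomial (Fin n) ℚ :=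
  aeval fun i => if h : 1 ≤ i ∧ i ≤ n then X (⟨i - 1, by omega⟩ : Fin n) else 0

/-- The quotient projection onto `R_{n,k}`. -/
def projNK (n k : ℕ) : MvPolynomial ℕ ℚ →ₐ[ℚ] (MvPolynomial (Fin n) ℚ ⧸ Jnk n k) :=
  (Ideal.Quotient.mkₐ ℚ (Jnk n k)).comp (toFin n)

/-! ### Corners, insertions and the induction/extension operators -/

/-- `v` is an external corner of `μ`. -/
def IsCorner (μ : YoungDiagram) (v : ℕ × ℕ) : Prop :=
  v ∉ μ.cells ∧ ∃ ν : YoungDiagram, ν.cells = insert v μ.cells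

/-- `S +̃ v := ev (ev S + v)`, where `+ v` places the entry `n + 1` in the box `v`. -/
def Sadd (n : ℕ) (S : Tab) (v : ℕ × ℕ) : Tab :=
  evac (n + 1) (Function.update (evac n S) v (n + 1))

/-- `δ^{S,v}`: `0` if `v` lies strictly below the row of `n` in `ev S`, and `1` otherwise. -/
def deltaSV (n : ℕ) (S : Tab) (v : ℕ × ℕ) : ℕ :=
  if rowIdx (evac n S) n < v.1 then 0 else 1

/-- `h + δ·1_t`: add `δ` to the coordinate `t` of `h` when `t ≥ 1`; do nothing for `t = 0`. -/
def addAt (h : ℕ → ℕ) (t δ : ℕ) : ℕ → ℕ := fun r =>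
  if r = t ∧ 1 ≤ t then h r + δ else h r

/-- The induction operator on a single summand:
`Ind_t V^S_h := ⊕_{v ∈ EC(λ)} V^{S +̃ v}_{h + δ^{S,v}·1_t}`. -/
def IndVSh (t n : ℕ) (μ : YoungDiagram) (S : Tab) (h : ℕ → ℕ) :
    Submodule ℚ (MvPolynomial ℕ ℚ) :=
  ⨆ v : ℕ × ℕ, ⨆ _ : IsCorner μ v,
    VSh (n + 1) (insert v μ.cells) (Sadd n S v) (addAt h t (deltaSV n S v))

/-- The extension operator on a single summand:
`Ext V^S_h := ⊕_{v ∈ EC(λ), δ^{S,v} = 1} V^{S +̃ v}_h`. -/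
def ExtVSh (n : ℕ) (μ : YoungDiagram) (S : Tab) (h : ℕ → ℕ) :
    Submodule ℚ (MvPolynomial ℕ ℚ) :=
  ⨆ v : ℕ × ℕ, ⨆ _ : IsCorner μ v ∧ deltaSV n S v = 1,
    VSh (n + 1) (insert v μ.cells) (Sadd n S v) h

/-- `Ind_t R_{n,I}`, applied summand-by-summand to the decomposition of `R_{n,I}`. -/
def IndR (t n : ℕ) (I : Finset ℕ) : Submodule ℚ (MvPolynomial ℕ ℚ) :=
  ⨆ q : SIdx n I, IndVSh t n q.1.1 q.1.2 (hSI n I q.1.2)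

/-- `Ext R_{n,I}`, applied summand-by-summand. -/
def ExtR (n : ℕ) (I : Finset ℕ) : Submodule ℚ (MvPolynomial ℕ ℚ) :=
  ⨆ q : SIdx n I, ExtVSh n q.1.1 q.1.2 (hSI n I q.1.2)

/-- `Ind_t R^hom_{n,I}`, applied summand-by-summand. -/
def IndRhom (t n : ℕ) (I : Finset ℕ) : Submodule ℚ (MvPolynomial ℕ ℚ) :=
  ⨆ q : SIdx n I, IndVSh t n q.1.1 q.1.2 (hInd n I q.1.2)

/-- `Ext R^hom_{n,I}`, applied summand-by-summand. -/
def ExtRhom (n : ℕ) (I : Finset ℕ) : Submodule ℚ (MvPolynomial ℕ ℚ) :=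
  ⨆ q : SIdx n I, ExtVSh n q.1.1 q.1.2 (hInd n I q.1.2)

/-- The lift `R̃_{n,k} = ⊕_{|I| = k-1} R_{n,I}` of the quotient `R_{n,k}`. -/
def Rtil (n k : ℕ) : Submodule ℚ (MvPolynomial ℕ ℚ) :=
  ⨆ I : Finset ℕ, ⨆ _ : I ⊆ Finset.Ioo 0 n ∧ I.card + 1 = k, RnI n I

/-! ### The extended column group -/

/-- The length of column `c` of a tableau. -/
def colLenT (n : ℕ) (T : Tab) (c : ℕ) : ℕ :=
  ((Finset.range (n + 1)).filter fun r => T (r, c) ≠ 0).card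

/-- `q_a`: the number of columns of length `> a` (columns of length `a` occupy the
`0`-indexed columns `q_a, …, q_a + t_a - 1`). -/
def qaT (n : ℕ) (T : Tab) (a : ℕ) : ℕ :=
  ((Finset.range (n + 1)).filter fun c => a < colLenT n T c).card

/-- `t_a`: the number of columns of length `a`. -/
def taT (n : ℕ) (T : Tab) (a : ℕ) : ℕ :=
  ((Finset.range (n + 1)).filter fun c => colLenT n T c = a).card

/-- The function underlying the permutation `η_T`: the entry in row `j` of column `q_a + i`
is sent to the entry in row `j` of column `q_a + η(i)`; everything else is fixed. -/
def etaFun (n : ℕ) (T : Tab) (a : ℕ) (η : Equiv.Perm ℕ) : ℕ → ℕ := fun m =>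
  let c := colIdx T m
  if 1 ≤ m ∧ m ≤ n ∧ qaT n T a ≤ c ∧ c < qaT n T a + taT n T a then
    T (rowIdx T m, qaT n T a + η (c - qaT n T a))
  else m

/-- The set of the permutations `η_T` (over all `a ≥ 1` and all `η ∈ S_{t_a}`). -/
def etaSet (n : ℕ) (T : Tab) : Set (Equiv.Perm ℕ) :=
  {w | ∃ a, 1 ≤ a ∧ ∃ η : Equiv.Perm ℕ, (∀ i, taT n T a ≤ i → η i = i) ∧
    ⇑w = etaFun n T a η}

/-- The subgroup generated by the permutations `η_T` (a copy of `Π_a S_{t_a}`). -/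
def etaSubgroup (n : ℕ) (T : Tab) : Subgroup (Equiv.Perm ℕ) :=
  Subgroup.closure (etaSet n T)

/-- The column group `C(T)` as a subgroup. -/
def colSubgroup (n : ℕ) (T : Tab) : Subgroup (Equiv.Perm ℕ) :=
  Subgroup.closure (colGroupSet n T)

/-- The extended column group `C̃(T)`, generated by `C(T)` and the `η_T`. -/
def extColSubgroup (n : ℕ) (T : Tab) : Subgroup (Equiv.Perm ℕ) :=
  Subgroup.closure (colGroupSet n T ∪ etaSet n T)

/-- The sign of a permutation of `ℕ` supported on `{1, …, n}`. -/
def signOn (n : ℕ) (σ : Equiv.Perm ℕ) : ℤ :=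
  if h : ∃ τ : Equiv.Perm (Fin n), embedPerm n τ = σ then
    (Equiv.Perm.sign h.choose : ℤ) else 0

/-! ### Semistandard tableaux, (generalized) cocharge tableaux -/

/-- A semistandard filling of the given cells: rows weakly increase, columns strictly
increase (entries outside the cells are normalized to `0`). -/
def IsSSYTOn (cells : Finset (ℕ × ℕ)) (C : Tab) : Prop :=
  (∀ c ∉ cells, C c = 0) ∧
  (∀ c₁ ∈ cells, ∀ c₂ ∈ cells, c₁.1 = c₂.1 → c₁.2 ≤ c₂.2 → C c₁ ≤ C c₂) ∧
  (∀ c₁ ∈ cells, ∀ c₂ ∈ cells, c₁.2 = c₂.2 → c₁.1 < c₂.1 → C c₁ < C c₂)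

/-- A generalized cocharge tableau with entries exactly `{0, …, k-1}`. -/
def IsGCT (cells : Finset (ℕ × ℕ)) (C : Tab) (k : ℕ) : Prop :=
  IsSSYTOn cells C ∧ (∀ c ∈ cells, C c < k) ∧ ∀ h < k, ∃ c ∈ cells, C c = h

/-- The type of a generalized cocharge tableau: the set of cumulative multiplicities
`#{c : C c < h}` for `1 ≤ h ≤ k - 1`. -/
def gctType (cells : Finset (ℕ × ℕ)) (C : Tab) (k : ℕ) : Finset ℕ :=
  (Finset.Ico 1 k).image fun h => (cells.filter fun c => C c < h).card

/-- The standardization of a semistandard tableau: entries are replaced by `1, …, n`,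
processing the values in increasing order and, for equal values, from left to right. -/
def stdz (cells : Finset (ℕ × ℕ)) (C : Tab) : Tab := fun c =>
  if c ∈ cells then
    (cells.filter fun c' => C c' < C c ∨
      (C c' = C c ∧ (c'.2 < c.2 ∨ (c'.2 = c.2 ∧ c'.1 ≤ c.1)))).card
  else 0

/-- A cocharge tableau of shape `μ`: one of the form `ct S` for a standard `S`. -/
def IsCCT (μ : YoungDiagram) (C : Tab) : Prop :=
  ∃ S : Tab, IsStandard μ S ∧ ctTab μ.cells.card S = C

/-- `k` for a tableau: one more than the maximal entry. -/
def kOf (cells : Finset (ℕ × ℕ)) (C : Tab) : ℕ := cells.sup C + 1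

/-- `Dsp^c(C) := {n - i : i ∈ J}`, `J` the type of the cocharge tableau `C`. -/
def Dspc (n : ℕ) (cells : Finset (ℕ × ℕ)) (C : Tab) : Finset ℕ :=
  (gctType cells C (kOf cells C)).image fun i => n - i

/-- The entry sum `Σ(C)`. -/
def entrySum (cells : Finset (ℕ × ℕ)) (C : Tab) : ℕ := ∑ c ∈ cells, C c

/-- `C +̂ v := ct (ct⁻¹(C) +̃ v)`, where `ct⁻¹` is the standardization. -/
def Cadd (n : ℕ) (μ : YoungDiagram) (C : Tab) (v : ℕ × ℕ) : Tab :=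
  ctTab (n + 1) (Sadd n (stdz μ.cells C) v)

/-- The standard Young tableau `S⁰` of shape `μ` filling the rows consecutively. -/
def rowWordTab (μ : YoungDiagram) : Tab := fun c =>
  if c ∈ μ.cells then (∑ r ∈ Finset.range c.1, μ.rowLen r) + c.2 + 1 else 0

/-- The word of an ordered set partition: the blocks listed in order, each sorted
increasingly. -/
def opWord (k : ℕ) (B : ℕ → Finset ℕ) : List ℕ :=
  (List.range k).foldr (fun h acc => (B h).sort (· ≤ ·) ++ acc) []

/-- Renaming the variables of a power series along a permutation. -/
def permSeries (g : Equiv.Perm ℕ) (F : MvPowerSeries ℕ ℚ) : MvPowerSeries ℕ ℚ :=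
  fun m => F (Finsupp.mapDomain ⇑g⁻¹ m)


/-! ### Standard tableaux as growth sequences of cells -/

/-- `x` is the right or lower neighbour of `h`. -/
def adjC (h x : ℕ × ℕ) : Prop := x = (h.1, h.2 + 1) ∨ x = (h.1 + 1, h.2)

/-- Position of the hole after processing entries up to `j`. -/
def holeP (p : ℕ → ℕ × ℕ) : ℕ → ℕ × ℕ
  | 0 => (0, 0)
  | j + 1 => if adjC (holeP p j) (p (j + 1)) then p (j + 1) else holeP p j

theorem holeP_succ (p : ℕ → ℕ × ℕ) (j : ℕ) : holeP p (j + 1) =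
    if adjC (holeP p j) (p (j + 1)) then p (j + 1) else holeP p j := rfl

/-- The promoted growth sequence. -/
def delP (p : ℕ → ℕ × ℕ) : ℕ → ℕ × ℕ := fun j =>
  if adjC (holeP p j) (p (j + 1)) then holeP p j else p (j + 1)

/-- The set of the first `j` cells. -/
def cellsP (p : ℕ → ℕ × ℕ) (j : ℕ) : Set (ℕ × ℕ) := {x | ∃ i, 1 ≤ i ∧ i ≤ j ∧ p i = x}

/-- Growth sequences of Young diagrams. -/
structure StdP (n : ℕ) (p : ℕ → ℕ × ℕ) : Prop where
  notin : ∀ j, j + 1 ≤ n → p (j + 1) ∉ cellsP p j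
  low : ∀ j, j ≤ n → ∀ a b c d, (a, b) ∈ cellsP p j → c ≤ a → d ≤ b → (c, d) ∈ cellsP p j

theorem cellsP_succ (p : ℕ → ℕ × ℕ) (j : ℕ) (x : ℕ × ℕ) :
    x ∈ cellsP p (j + 1) ↔ x ∈ cellsP p j ∨ x = p (j + 1) := by
  constructor
  · rintro ⟨i, h1, h2, h3⟩
    by_cases h : i = j + 1
    · subst h; exact Or.inr h3.symm
    · exact Or.inl ⟨i, h1, by omega, h3⟩
  · rintro (⟨i, h1, h2, h3⟩ | h)
    · exact ⟨i, h1, by omega, h3⟩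
    · exact ⟨j + 1, by omega, le_refl _, h.symm⟩

theorem cellsP_zero (p : ℕ → ℕ × ℕ) (x : ℕ × ℕ) : x ∉ cellsP p 0 := by
  rintro ⟨i, h1, h2, h3⟩; omega

theorem StdP.one {n : ℕ} {p : ℕ → ℕ × ℕ} (h : StdP n p) (hn : 1 ≤ n) : p 1 = (0, 0) := by
  have h1 : p 1 ∈ cellsP p 1 := ⟨1, le_refl _, le_refl _, rfl⟩
  obtain ⟨i, h2, h3, h4⟩ := h.low 1 hn (p 1).1 (p 1).2 0 0 h1 (Nat.zero_le _) (Nat.zero_le _)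
  have : i = 1 := by omega
  subst this; exact h4

theorem StdP.mono {n m : ℕ} {p : ℕ → ℕ × ℕ} (h : StdP n p) (hm : m ≤ n) : StdP m p :=
  ⟨fun j hj => h.notin j (by omega), fun j hj => h.low j (by omega)⟩

theorem holeP_one {n : ℕ} {p : ℕ → ℕ × ℕ} (h : StdP n p) (hn : 1 ≤ n) : holeP p 1 = (0, 0) := by
  have := h.one hn
  simp [holeP, adjC, this]

theorem holeP_inv {n : ℕ} {p : ℕ → ℕ × ℕ} (h : StdP n p) (j : ℕ) (hj : j + 1 ≤ n) :
    holeP p (j + 1) ∈ cellsP p (j + 1) ∧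
    ((holeP p (j + 1)).1, (holeP p (j + 1)).2 + 1) ∉ cellsP p (j + 1) ∧
    ((holeP p (j + 1)).1 + 1, (holeP p (j + 1)).2) ∉ cellsP p (j + 1) := by
  induction j with
  | zero =>
    have h1 := h.one hj
    have h2 := holeP_one h hj
    simp only [zero_add, h2, cellsP_succ, h1]
    simp [cellsP_zero]
  | succ j ih =>
    obtain ⟨i1, i2, i3⟩ := ih (by omega)
    have hl := h.low (j + 1) (by omega)
    have hn := h.notin (j + 1) hj
    rw [holeP]
    generalize holeP p (j + 1) = q at *
    generalize hx : p (j + 1 + 1) = x at *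
    obtain ⟨r, c⟩ := q
    obtain ⟨a, b⟩ := x
    simp only [cellsP_succ p (j + 1), hx]
    split_ifs with hadj
    · refine ⟨Or.inr rfl, ?_, ?_⟩
      · rintro (h' | h')
        · exact hn (hl _ _ _ _ h' (by simp) (by simp))
        · simp at h'
      · rintro (h' | h')
        · exact hn (hl _ _ _ _ h' (by simp) (by simp))
        · simp at h'
    · simp only [adjC, not_or] at hadj
      refine ⟨Or.inl i1, ?_, ?_⟩
      · rintro (h' | h')
        · exact i2 h'
        · exact hadj.1 h'.symm
      · rintro (h' | h')
        · exact i3 h'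
        · exact hadj.2 h'.symm

theorem cellsP_del {n : ℕ} {p : ℕ → ℕ × ℕ} (h : StdP n p) (j : ℕ) (hj : j + 1 ≤ n) (x : ℕ × ℕ) :
    x ∈ cellsP (delP p) j ↔ x ∈ cellsP p (j + 1) ∧ x ≠ holeP p (j + 1) := by
  induction j with
  | zero =>
    have h1 := h.one hj
    have h2 := holeP_one h hj
    simp only [zero_add, h2, cellsP_succ, h1]
    simp [cellsP_zero]
  | succ j ih =>
    have ih := ih (by omega)
    obtain ⟨i1, i2, i3⟩ := holeP_inv h j (by omega)
    have hn := h.notin (j + 1) hj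
    rw [cellsP_succ, ih, cellsP_succ p (j + 1), delP, holeP_succ p (j + 1)]
    split_ifs with hadj
    · constructor
      · rintro (⟨a, b⟩ | a)
        · refine ⟨Or.inl a, ?_⟩
          rintro rfl; exact hn a
        · subst a
          refine ⟨Or.inl i1, fun e => hn (e ▸ i1)⟩
      · rintro ⟨a | a, b⟩
        · by_cases e : x = holeP p (j + 1)
          · exact Or.inr e
          · exact Or.inl ⟨a, e⟩
        · exact absurd a b
    · constructor
      · rintro (⟨a, b⟩ | a)
        · exact ⟨Or.inl a, b⟩
        · refine ⟨Or.inr a, ?_⟩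
          rintro rfl; rw [a] at i1; exact hn i1
      · rintro ⟨a | a, b⟩
        · exact Or.inl ⟨a, b⟩
        · exact Or.inr a

theorem StdP.del {n : ℕ} {p : ℕ → ℕ × ℕ} (h : StdP (n + 1) p) : StdP n (delP p) := by
  constructor
  · intro j hj hm
    rw [cellsP_del h j (by omega)] at hm
    have hn := h.notin (j + 1) (by omega)
    rw [delP] at hm
    split_ifs at hm
    · exact hm.2 rfl
    · exact hn hm.1
  · intro j hj a b c d hab hc hd
    rw [cellsP_del h j (by omega)] at hab ⊢
    have hl := h.low (j + 1) (by omega)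
    obtain ⟨i1, i2, i3⟩ := holeP_inv h j (by omega)
    refine ⟨hl _ _ _ _ hab.1 hc hd, ?_⟩
    intro e
    rw [← e] at i2 i3 hab
    by_cases h1 : c < a
    · exact i3 (hl _ _ _ _ hab.1 (by simpa using h1) (by simpa using hd))
    · by_cases h2 : d < b
      · exact i2 (hl _ _ _ _ hab.1 (by simpa using hc) (by simpa using h2))
      · apply hab.2
        ext <;> simp <;> omega

/-- Descent of a growth sequence. -/
def descP (p : ℕ → ℕ × ℕ) (i : ℕ) : Prop := (p i).1 < (p (i + 1)).1

theorem descP_del {n : ℕ} {p : ℕ → ℕ × ℕ} (h : StdP n p) (j : ℕ) (hj : j + 3 ≤ n) :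
    descP (delP p) (j + 1) ↔ descP p (j + 2) := by
  obtain ⟨i1, i2, i3⟩ := holeP_inv h j (by omega)
  have hl1 := h.low (j + 1) (by omega)
  have hl2 := h.low (j + 2) (by omega)
  have hl3 := h.low (j + 3) (by omega)
  have hn1 := h.notin (j + 1) (by omega)
  have hn2 := h.notin (j + 2) (by omega)
  have hs2 := cellsP_succ p (j + 1)
  have hs3 := cellsP_succ p (j + 2)
  unfold descP delP
  rw [show j + 1 + 1 = j + 2 from rfl, show j + 2 + 1 = j + 3 from rfl] at *
  rw [show holeP p (j + 2) = if adjC (holeP p (j + 1)) (p (j + 2)) then p (j + 2)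
    else holeP p (j + 1) from rfl]
  generalize holeP p (j + 1) = q at *
  generalize p (j + 2) = x at *
  generalize p (j + 3) = y at *
  generalize cellsP p (j + 1) = A at *
  generalize cellsP p (j + 2) = B at *
  generalize cellsP p (j + 3) = C at *
  obtain ⟨r, c⟩ := q
  obtain ⟨a, b⟩ := x
  obtain ⟨d, e⟩ := y
  have hxB : (a, b) ∈ B := (hs2 _).2 (Or.inr rfl)
  have hyC : (d, e) ∈ C := (hs3 _).2 (Or.inr rfl)
  have hAB : ∀ u v, (u, v) ∈ B → ((u, v) ∈ A ∨ (u = a ∧ v = b)) := by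
    intro u v huv; rcases (hs2 _).1 huv with h | h
    · exact Or.inl h
    · right; simpa using h
  have hAC : ∀ u v, (u, v) ∈ C → ((u, v) ∈ A ∨ (u = a ∧ v = b) ∨ (u = d ∧ v = e)) := by
    intro u v huv; rcases (hs3 _).1 huv with h | h
    · rcases hAB _ _ h with h | h <;> tauto
    · right; right; simpa using h
  by_cases hx : adjC (r, c) (a, b)
  · simp only [hx, if_true]
    rcases hx with hx | hx
    · simp only [Prod.mk.injEq] at hx
      obtain ⟨rfl, rfl⟩ := hx
      by_cases hy : adjC (a, c + 1) (d, e)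
      · simp only [hy, if_true]
        rcases hy with hy | hy
        · simp only [Prod.mk.injEq] at hy
          obtain ⟨rfl, rfl⟩ := hy
          simp
        · simp only [Prod.mk.injEq] at hy
          obtain ⟨rfl, rfl⟩ := hy
          exfalso
          have := hl3 _ _ (a + 1) c hyC (by omega) (by omega)
          rcases hAC _ _ this with h | h | h
          · exact i3 h
          · omega
          · omega
      · simp only [hy, if_false]
    · simp only [Prod.mk.injEq] at hx
      obtain ⟨rfl, rfl⟩ := hx
      by_cases hy : adjC (r + 1, b) (d, e)
      · simp only [hy, if_true]
        rcases hy with hy | hy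
        · simp only [Prod.mk.injEq] at hy
          obtain ⟨rfl, rfl⟩ := hy
          exfalso
          have := hl3 _ _ r (b + 1) hyC (by omega) (by omega)
          rcases hAC _ _ this with h | h | h
          · exact i2 h
          · omega
          · omega
        · simp only [Prod.mk.injEq] at hy
          obtain ⟨rfl, rfl⟩ := hy
          simp
      · simp only [hy, if_false]
        have : d ≠ r + 1 := by
          rintro rfl
          rcases lt_trichotomy e b with h | h | h
          · exact hn2 (hl2 _ _ _ _ hxB le_rfl h.le)
          · subst h; exact hn2 hxB
          · have := hl3 _ _ (r + 1) (b + 1) hyC (by omega) (by omega)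
            rcases hAC _ _ this with h' | h' | h'
            · exact hn1 (hl1 _ _ _ _ h' (by omega) (by omega))
            · omega
            · apply hy; left; simp; omega
        omega
  · simp only [hx, if_false]
    by_cases hy : adjC (r, c) (d, e)
    · simp only [hy, if_true]
      rcases hy with hy | hy
      · simp only [Prod.mk.injEq] at hy
        obtain ⟨rfl, rfl⟩ := hy
        simp
      · simp only [Prod.mk.injEq] at hy
        obtain ⟨rfl, rfl⟩ := hy
        have : a ≠ r := by
          rintro rfl
          rcases lt_trichotomy b e with h | h | h
          · exact hn1 (hl1 _ _ _ _ i1 le_rfl h.le)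
          · subst h; exact hn1 i1
          · have := hl2 _ _ a (e + 1) hxB (by omega) (by omega)
            rcases hAB _ _ this with h' | h'
            · exact i2 h'
            · apply hx; left; simp; omega
        omega
    · simp only [hy, if_false]

theorem two_holes_right {n : ℕ} {p : ℕ → ℕ × ℕ} (h : StdP n p) (h2 : p 2 = (0, 1))
    (j : ℕ) (hj : j + 2 ≤ n) :
    (holeP p (j + 2)).1 ≤ (holeP (delP p) (j + 1)).1 ∧
    (holeP (delP p) (j + 1)).2 < (holeP p (j + 2)).2 := by
  have hd : StdP (n - 1) (delP p) := StdP.del (by rwa [show n - 1 + 1 = n by omega])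
  induction j with
  | zero =>
    have e1 := holeP_one h (by omega)
    have e2 := holeP_one hd (by omega)
    have e3 : holeP p 2 = (0, 1) := by
      rw [holeP]; simp [e1, h2, adjC]
    simp [e2, e3]
  | succ j ih =>
    have ih := ih (by omega)
    obtain ⟨i1, i2, i3⟩ := holeP_inv h (j + 1) (by omega)
    obtain ⟨k1, k2, k3⟩ := holeP_inv hd j (by omega)
    rw [cellsP_del h (j + 1) (by omega)] at k1 k2 k3
    have hl := h.low (j + 2) (by omega)
    have hl3 := h.low (j + 3) (by omega)
    have hn := h.notin (j + 2) (by omega)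
    have hs := cellsP_succ p (j + 2)
    rw [show j + 1 + 1 = j + 2 from rfl, show j + 2 + 1 = j + 3 from rfl,
      show j + 1 + 2 = j + 3 from rfl] at *
    rw [show holeP p (j + 3) = if adjC (holeP p (j + 2)) (p (j + 3)) then p (j + 3)
        else holeP p (j + 2) from rfl,
      show holeP (delP p) (j + 2) = if adjC (holeP (delP p) (j + 1)) (delP p (j + 2)) then
        delP p (j + 2) else holeP (delP p) (j + 1) from rfl,
      show delP p (j + 2) = if adjC (holeP p (j + 2)) (p (j + 3)) then holeP p (j + 2)
        else p (j + 3) from rfl]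
    generalize holeP p (j + 2) = u at *
    generalize holeP (delP p) (j + 1) = v at *
    generalize p (j + 3) = x at *
    generalize cellsP p (j + 2) = A at *
    generalize cellsP p (j + 3) = B at *
    obtain ⟨r, c⟩ := u
    obtain ⟨s, d⟩ := v
    obtain ⟨a, b⟩ := x
    have hxB : (a, b) ∈ B := (hs _).2 (Or.inr rfl)
    have hAB : ∀ u v, (u, v) ∈ B → ((u, v) ∈ A ∨ (u = a ∧ v = b)) := by
      intro u v huv; rcases (hs _).1 huv with h | h
      · exact Or.inl h
      · right; simpa using h
    simp only [Ne, Prod.mk.injEq, not_and] at *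
    have k2' : ∀ u v, (u, v) ∈ A → u = s → v = d + 1 → s = r ∧ d + 1 = c := by
      rintro u v huv rfl rfl; have := k2 huv; omega
    by_cases hx : adjC (r, c) (a, b)
    · simp only [hx, if_true]
      rcases hx with hx | hx
      · simp only [Prod.mk.injEq] at hx
        obtain ⟨rfl, rfl⟩ := hx
        split_ifs with hv
        · simp
        · simp only; omega
      · simp only [Prod.mk.injEq] at hx
        obtain ⟨rfl, rfl⟩ := hx
        have key : r + 1 ≤ s := by
          by_contra hlt
          have hsr : s = r := by omega
          subst hsr
          by_cases hdb : d + 1 = b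
          · subst hdb
            have := hl3 _ _ (s + 1) d hxB le_rfl (by omega)
            rcases hAB _ _ this with h' | h'
            · have := k3 h'; omega
            · omega
          · have := k2 (hl _ _ s (d + 1) i1 le_rfl (by omega))
            omega
        split_ifs with hv
        · exfalso
          simp only [adjC, Prod.mk.injEq] at hv; omega
        · simp only; omega
    · simp only [hx, if_false]
      split_ifs with hv
      · rcases hv with hv | hv
        · simp only [Prod.mk.injEq] at hv
          obtain ⟨rfl, rfl⟩ := hv
          refine ⟨ih.1, ?_⟩
          simp only
          by_contra hlt
          have hdc : d + 1 = c := by omega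
          subst hdc
          have har : a ≠ r := by
            rintro rfl; exact hn i1
          have := hl3 _ _ (r + 1) (d + 1) hxB (by omega) le_rfl
          rcases hAB _ _ this with h' | h'
          · exact i3 h'
          · apply hx; right; simp; omega
        · simp only [Prod.mk.injEq] at hv
          obtain ⟨rfl, rfl⟩ := hv
          simp only; omega
      · exact ih

/-- Transposition of growth sequences. -/
def trP (p : ℕ → ℕ × ℕ) : ℕ → ℕ × ℕ := fun i => (p i).swap

theorem adjC_swap (h x : ℕ × ℕ) : adjC h.swap x.swap ↔ adjC h x := by
  obtain ⟨a, b⟩ := h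
  obtain ⟨c, d⟩ := x
  simp [adjC]
  tauto

theorem holeP_tr (p : ℕ → ℕ × ℕ) (j : ℕ) : holeP (trP p) j = (holeP p j).swap := by
  induction j with
  | zero => rfl
  | succ j ih =>
    rw [holeP, holeP, ih]
    simp only [trP, adjC_swap]
    split_ifs <;> rfl

theorem delP_tr (p : ℕ → ℕ × ℕ) : delP (trP p) = trP (delP p) := by
  funext j
  simp only [delP, holeP_tr, trP, adjC_swap]
  split_ifs <;> rfl

theorem cellsP_tr (p : ℕ → ℕ × ℕ) (j : ℕ) (x : ℕ × ℕ) :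
    x ∈ cellsP (trP p) j ↔ x.swap ∈ cellsP p j := by
  constructor
  · rintro ⟨i, h1, h2, h3⟩
    exact ⟨i, h1, h2, by rw [← h3]; simp [trP]⟩
  · rintro ⟨i, h1, h2, h3⟩
    exact ⟨i, h1, h2, by simp [trP, h3]⟩

theorem StdP.tr {n : ℕ} {p : ℕ → ℕ × ℕ} (h : StdP n p) : StdP n (trP p) := by
  constructor
  · intro j hj hm
    rw [cellsP_tr] at hm
    exact h.notin j hj (by simpa [trP] using hm)
  · intro j hj a b c d hab hc hd
    rw [cellsP_tr] at hab ⊢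
    exact h.low j hj _ _ _ _ hab hd hc

theorem two_holes_down {n : ℕ} {p : ℕ → ℕ × ℕ} (h : StdP n p) (h2 : p 2 = (1, 0))
    (j : ℕ) (hj : j + 2 ≤ n) :
    (holeP (delP p) (j + 1)).1 < (holeP p (j + 2)).1 := by
  have := (two_holes_right h.tr (by simp [trP, h2]) j hj).2
  rw [delP_tr, holeP_tr, holeP_tr] at this
  exact this

theorem StdP.two {n : ℕ} {p : ℕ → ℕ × ℕ} (h : StdP n p) (hn : 2 ≤ n) :
    p 2 = (0, 1) ∨ p 2 = (1, 0) := by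
  have h1 := h.one (by omega)
  have hl := h.low 2 hn
  have hm : p 2 ∈ cellsP p 2 := ⟨2, by omega, le_rfl, rfl⟩
  have hno := h.notin 1 hn
  have hs : ∀ x, x ∈ cellsP p 2 ↔ (x = (0, 0) ∨ x = p 2) := by
    intro x; rw [cellsP_succ, cellsP_succ]; simp [cellsP_zero, h1]
  have hs1 : (0, 0) ∈ cellsP p 1 := ⟨1, le_rfl, le_rfl, h1⟩
  simp only [Nat.reduceAdd] at hno
  generalize p 2 = x at *
  obtain ⟨a, b⟩ := x
  rcases a with _ | a
  · rcases b with _ | b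
    · exact absurd hs1 hno
    · left
      rcases (hs _).1 (hl _ _ 0 1 hm (by omega) (by omega)) with h | h
      · simp at h
      · exact h.symm
  · right
    rcases (hs _).1 (hl _ _ 1 0 hm (by omega) (by omega)) with h | h
    · simp at h
    · exact h.symm

/-- Evacuation of growth sequences. -/
def evP : ℕ → (ℕ → ℕ × ℕ) → (ℕ → ℕ × ℕ)
  | 0, _ => fun _ => (0, 0)
  | m + 1, p => Function.update (evP m (delP p)) (m + 1) (holeP p (m + 1))

theorem evP_le (m : ℕ) (p : ℕ → ℕ × ℕ) (i : ℕ) (hi : i ≤ m) :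
    evP (m + 1) p i = evP m (delP p) i := by
  rw [evP, Function.update_of_ne (by omega)]

theorem evP_last (m : ℕ) (p : ℕ → ℕ × ℕ) : evP (m + 1) p (m + 1) = holeP p (m + 1) := by
  rw [evP, Function.update_self]

theorem descP_ev (n : ℕ) : ∀ (p : ℕ → ℕ × ℕ), StdP n p → ∀ i, 1 ≤ i → i < n →
    (descP (evP n p) (n - i) ↔ descP p i) := by
  induction n with
  | zero => intro p _ i h1 h2; omega
  | succ m ih =>
    intro p h i h1 h2
    by_cases hi : i = 1
    · subst hi
      obtain ⟨k, rfl⟩ : ∃ k, m = k + 1 := ⟨m - 1, by omega⟩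
      have hp1 := h.one (by omega)
      rw [show k + 1 + 1 - 1 = k + 1 by omega]
      unfold descP
      rw [evP_last, evP_le _ _ _ le_rfl, evP_last, hp1]
      rcases h.two (by omega) with h' | h'
      · have := (two_holes_right h h' k (by omega)).1
        simp only [Nat.reduceAdd, h']
        rw [show k + 1 + 1 = k + 2 from rfl]
        omega
      · have := two_holes_down h h' k (by omega)
        simp only [Nat.reduceAdd, h']
        rw [show k + 1 + 1 = k + 2 from rfl]
        omega
    · obtain ⟨j, rfl⟩ : ∃ j, i = j + 2 := ⟨i - 2, by omega⟩
      rw [← descP_del h j (by omega), ← ih (delP p) h.del (j + 1) (by omega) (by omega)]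
      unfold descP
      rw [evP_le _ _ _ (by omega), evP_le _ _ _ (by omega)]
      rw [show m + 1 - (j + 2) = m - (j + 1) by omega]

theorem cellsP_ev (n : ℕ) : ∀ (p : ℕ → ℕ × ℕ), StdP n p → ∀ x,
    x ∈ cellsP (evP n p) n ↔ x ∈ cellsP p n := by
  induction n with
  | zero => intro p _ x; simp [cellsP_zero]
  | succ m ih =>
    intro p h x
    have h1 := ih (delP p) h.del x
    have h2 := cellsP_del h m le_rfl x
    have h3 : x ∈ cellsP (evP (m + 1) p) m ↔ x ∈ cellsP (evP m (delP p)) m := by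
      constructor
      · rintro ⟨i, a, b, c⟩
        exact ⟨i, a, b, by rw [← c, evP_le _ _ _ b]⟩
      · rintro ⟨i, a, b, c⟩
        exact ⟨i, a, b, by rw [← c, evP_le _ _ _ b]⟩
    rw [cellsP_succ, h3, h1, h2, evP_last]
    have := (holeP_inv h m le_rfl).1
    constructor
    · rintro (h | rfl)
      · exact h.1
      · exact this
    · intro h
      by_cases e : x = holeP p (m + 1)
      · exact Or.inr e
      · exact Or.inl ⟨h, e⟩

/-! ### Tableaux represented by growth sequences -/

/-- The tableau `T` with `n` boxes has its entry `i` in the cell `p i`. -/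
structure RepT (n : ℕ) (T : Tab) (p : ℕ → ℕ × ℕ) : Prop where
  val : ∀ i, 1 ≤ i → i ≤ n → T (p i) = i
  supp : ∀ x, T x ≠ 0 → x ∈ cellsP p n

theorem RepT.eq_of {n : ℕ} {T : Tab} {p : ℕ → ℕ × ℕ} (h : RepT n T p) {i : ℕ} (h1 : 1 ≤ i)
    {x : ℕ × ℕ} (hx : T x = i) : x = p i := by
  obtain ⟨k, k1, k2, rfl⟩ := h.supp x (by omega)
  rw [h.val k k1 k2] at hx
  rw [hx]

theorem RepT.rowIdx_eq {n : ℕ} {T : Tab} {p : ℕ → ℕ × ℕ} (h : RepT n T p) {i : ℕ} (h1 : 1 ≤ i)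
    (h2 : i ≤ n) : rowIdx T i = (p i).1 := by
  have : {r | ∃ c, T (r, c) = i} = {(p i).1} := by
    ext r
    simp only [Set.mem_setOf_eq, Set.mem_singleton_iff]
    constructor
    · rintro ⟨c, hc⟩
      rw [← h.eq_of h1 hc]
    · rintro rfl
      exact ⟨(p i).2, h.val i h1 h2⟩
  rw [rowIdx, this, csInf_singleton]

theorem RepT.posOf_eq {n : ℕ} {T : Tab} {p : ℕ → ℕ × ℕ} (h : RepT n T p) {i : ℕ} (h1 : 1 ≤ i)
    (h2 : i ≤ n) : posOf T i = p i := by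
  have hm : colIdx T i ∈ {c | T (rowIdx T i, c) = i} := by
    apply Nat.sInf_mem
    rw [h.rowIdx_eq h1 h2]
    exact ⟨(p i).2, h.val i h1 h2⟩
  exact h.eq_of h1 hm

/-- State of a slide after the entries up to `j` have been processed. -/
structure StT (n : ℕ) (p : ℕ → ℕ × ℕ) (j : ℕ) (U : Tab) : Prop where
  big : ∀ i, j < i → i ≤ n → U (p i) = i
  small : ∀ i, 1 ≤ i → i < j → U (delP p i) = i + 1
  supp : ∀ x, U x ≠ 0 → x ∈ cellsP p n ∧ x ≠ holeP p j

theorem StdP.notin_lt {n : ℕ} {p : ℕ → ℕ × ℕ} (h : StdP n p) {i j : ℕ} (hij : j < i) (hi : i ≤ n)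
    : p i ∉ cellsP p j := by
  obtain ⟨k, rfl⟩ : ∃ k, i = k + 1 := ⟨i - 1, by omega⟩
  rintro ⟨l, a, b, c⟩
  exact h.notin k hi ⟨l, a, by omega, c⟩

theorem slide_St {n : ℕ} {p : ℕ → ℕ × ℕ} (h : StdP n p) (d : ℕ) : ∀ (j : ℕ) (U : Tab) (k : ℕ),
    j + 1 + d = n → d + 1 ≤ k → StT n p (j + 1) U →
    ∃ V, slide k U (holeP p (j + 1)) = (V, holeP p n) ∧ StT n p n V := by
  induction d with
  | zero =>
    intro j U k hj hk hU
    obtain ⟨k, rfl⟩ : ∃ k', k = k' + 1 := ⟨k - 1, by omega⟩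
    have hn : n = j + 1 := by omega
    subst hn
    obtain ⟨i1, i2, i3⟩ := holeP_inv h j le_rfl
    refine ⟨U, ?_, hU⟩
    have e1 : U ((holeP p (j + 1)).1, (holeP p (j + 1)).2 + 1) = 0 := by
      by_contra hne; exact i2 (hU.supp _ hne).1
    have e2 : U ((holeP p (j + 1)).1 + 1, (holeP p (j + 1)).2) = 0 := by
      by_contra hne; exact i3 (hU.supp _ hne).1
    simp [slide, slideOnce, e1, e2]
  | succ d ih =>
    intro j U k hj hk hU
    obtain ⟨i1, i2, i3⟩ := holeP_inv h j (by omega)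
    have hsub : ∀ x, x ∈ cellsP p (j + 1) → x ∈ cellsP p n := by
      rintro x ⟨l, a, b, c⟩; exact ⟨l, a, by omega, c⟩
    by_cases hadj : adjC (holeP p (j + 1)) (p (j + 2))
    · obtain ⟨k, rfl⟩ : ∃ k', k = k' + 1 := ⟨k - 1, by omega⟩
      have hh : holeP p (j + 2) = p (j + 2) := by
        rw [holeP_succ p (j + 1), if_pos hadj]
      have hd : delP p (j + 1) = holeP p (j + 1) := by
        rw [delP, if_pos hadj]
      have hxn : p (j + 2) ∉ cellsP p (j + 1) := h.notin_lt (by omega) (by omega)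
      have hxh : holeP p (j + 1) ≠ p (j + 2) := fun e => hxn (e ▸ i1)
      have hst : StT n p (j + 2) (Function.update (Function.update U (holeP p (j + 1))
          (U (p (j + 2)))) (p (j + 2)) 0) := by
        constructor
        · intro i a b
          have n1 : p i ≠ p (j + 2) := fun e =>
            h.notin_lt a b (e ▸ ⟨j + 2, by omega, le_rfl, rfl⟩)
          have n2 : p i ≠ holeP p (j + 1) := fun e =>
            h.notin_lt (show j + 1 < i by omega) b (e ▸ i1)
          rw [Function.update_of_ne n1, Function.update_of_ne n2]
          exact hU.big i (by omega) b
        · intro i a b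
          by_cases hi : i = j + 1
          · subst hi
            rw [hd, Function.update_of_ne hxh, Function.update_self]
            exact hU.big (j + 2) (by omega) (by omega)
          · have hm : delP p i ∈ cellsP (delP p) j := ⟨i, a, by omega, rfl⟩
            rw [cellsP_del h j (by omega)] at hm
            have n1 : delP p i ≠ p (j + 2) := fun e => hxn (e ▸ hm.1)
            rw [Function.update_of_ne n1, Function.update_of_ne hm.2]
            exact hU.small i a (by omega)
        · intro x hx
          rw [hh]
          by_cases e : x = p (j + 2)
          · subst e; simp at hx
          · refine ⟨?_, e⟩
            rw [Function.update_of_ne e] at hx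
            by_cases e' : x = holeP p (j + 1)
            · subst e'; exact hsub _ i1
            · rw [Function.update_of_ne e'] at hx
              exact (hU.supp x hx).1
      obtain ⟨V, hV, hV2⟩ := ih (j + 1) _ k (by omega) (by omega) hst
      refine ⟨V, ?_, hV2⟩
      rw [← hV, show j + 1 + 1 = j + 2 from rfl, hh]
      have hval := hU.big (j + 2) (by omega) (by omega)
      have hother : ∀ x, x ∉ cellsP p (j + 1) → x ≠ p (j + 2) → U x ≠ 0 → j + 2 < U x := by
        intro x hx1 hx2 hx3
        obtain ⟨⟨l, a, b, rfl⟩, -⟩ := hU.supp x hx3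
        have : j + 2 < l := by
          by_contra hlt
          by_cases e : l = j + 2
          · subst e; exact hx2 rfl
          · exact hx1 ⟨l, a, by omega, rfl⟩
        rw [hU.big l (by omega) b]; exact this
      have hso : slideOnce U (holeP p (j + 1)) = (Function.update (Function.update U
          (holeP p (j + 1)) (U (p (j + 2)))) (p (j + 2)) 0, p (j + 2)) := by
        rcases hadj with hadj | hadj
        · have o := hother _ i3 (by rw [hadj]; simp)
          rw [hadj] at hval
          rw [hadj]
          simp only [slideOnce, hval]
          rw [if_neg (by omega), if_pos (by omega)]
        · have o := hother _ i2 (by rw [hadj]; simp)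
          rw [hadj] at hval
          rw [hadj]
          simp only [slideOnce, hval]
          rw [if_neg (by omega), if_neg (by omega)]
      rw [slide]
      simp only [hso]
      rw [if_neg (Ne.symm hxh)]
    · have hh : holeP p (j + 2) = holeP p (j + 1) := by
        rw [holeP_succ p (j + 1), if_neg hadj]
      have hd : delP p (j + 1) = p (j + 2) := by
        rw [delP, if_neg hadj]
      have hst : StT n p (j + 2) U := by
        constructor
        · intro i a b; exact hU.big i (by omega) b
        · intro i a b
          by_cases hi : i = j + 1
          · subst hi; rw [hd]; exact hU.big (j + 2) (by omega) (by omega)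
          · exact hU.small i a (by omega)
        · intro x hx; rw [hh]; exact hU.supp x hx
      obtain ⟨V, hV, hV2⟩ := ih (j + 1) _ k (by omega) (by omega) hst
      exact ⟨V, by rw [← hV, show j + 1 + 1 = j + 2 from rfl, hh], hV2⟩

theorem evac_rep (n : ℕ) : ∀ (T : Tab) (p : ℕ → ℕ × ℕ), StdP n p → RepT n T p →
    RepT n (evacAux n T) (evP n p) := by
  induction n with
  | zero =>
    intro T p h hr
    exact ⟨fun i a b => by omega, fun x hx => absurd rfl hx⟩
  | succ m ih =>
    intro T p h hr
    have hp : posOf T 1 = p 1 := hr.posOf_eq le_rfl (by omega)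
    have hh : holeP p 1 = p 1 := by rw [holeP_one h (by omega), h.one (by omega)]
    have hst : StT (m + 1) p 1 (Function.update T (p 1) 0) := by
      constructor
      · intro i a b
        have n1 : p i ≠ p 1 := fun e =>
            h.notin_lt a b (e ▸ ⟨1, by omega, le_rfl, rfl⟩)
        rw [Function.update_of_ne n1]
        exact hr.val i (by omega) b
      · intro i a b; omega
      · intro x hx
        rw [hh]
        by_cases e : x = p 1
        · subst e; simp at hx
        · rw [Function.update_of_ne e] at hx
          exact ⟨hr.supp x hx, e⟩
    obtain ⟨V, hV, hV2⟩ := slide_St h m 0 _ (m + 1) (by omega) (by omega) hst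
    rw [zero_add, hh] at hV
    have hrep : RepT m (fun c => V c - 1) (delP p) := by
      constructor
      · intro i a b
        rw [hV2.small i a (by omega)]; omega
      · intro x hx
        rw [cellsP_del h m le_rfl]
        exact hV2.supp x (by intro e; simp [e] at hx)
    have hI := ih _ _ h.del hrep
    have he : evacAux (m + 1) T = Function.update (evacAux m fun c => V c - 1)
        (holeP p (m + 1)) (m + 1) := by
      rw [evacAux]
      simp only [hp, hV]
    rw [he]
    constructor
    · intro i a b
      by_cases hi : i = m + 1
      · subst hi
        rw [evP_last, Function.update_self]
      · rw [evP_le _ _ _ (by omega)]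
        have hm : evP m (delP p) i ∈ cellsP (evP m (delP p)) m := ⟨i, a, by omega, rfl⟩
        rw [cellsP_ev m _ h.del, cellsP_del h m le_rfl] at hm
        rw [Function.update_of_ne hm.2]
        exact hI.val i a (by omega)
    · intro x hx
      rw [cellsP_ev _ _ h]
      by_cases e : x = holeP p (m + 1)
      · subst e; exact (holeP_inv h m le_rfl).1
      · rw [Function.update_of_ne e] at hx
        have := hI.supp x hx
        rw [cellsP_ev m _ h.del, cellsP_del h m le_rfl] at this
        exact this.1

theorem ccStat_eq {n : ℕ} {T : Tab} {p : ℕ → ℕ × ℕ} (h : RepT n T p) :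
    ccStat n T = ∑ j ∈ DsiSet n T, (n - j) := by
  have h1 : ccStat n T = ∑ i ∈ Finset.Icc 1 n, ∑ j ∈ DsiSet n T, if j < i then 1 else 0 := by
    unfold ccStat
    apply Finset.sum_congr rfl
    intro i hi
    rw [Finset.mem_Icc] at hi
    rw [ctEntry, h.posOf_eq hi.1 hi.2, h.val i hi.1 hi.2, Finset.card_filter]
  rw [h1, Finset.sum_comm]
  apply Finset.sum_congr rfl
  intro j hj
  rw [← Finset.card_filter]
  have : (Finset.Icc 1 n).filter (fun i => j < i) = Finset.Ioc j n := by
    ext i; simp only [Finset.mem_filter, Finset.mem_Icc, Finset.mem_Ioc]; omega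
  rw [this, Nat.card_Ioc]

theorem mem_DsiSet {n : ℕ} {T : Tab} {p : ℕ → ℕ × ℕ} (h : RepT n T p) (i : ℕ) :
    i ∈ DsiSet n T ↔ (1 ≤ i ∧ i < n) ∧ descP p i := by
  simp only [DsiSet, Finset.mem_filter, Finset.mem_Ioo, descP]
  constructor
  · rintro ⟨a, b⟩
    rw [h.rowIdx_eq (by omega) (by omega), h.rowIdx_eq (by omega) (by omega)] at b
    exact ⟨⟨by omega, a.2⟩, b⟩
  · rintro ⟨a, b⟩
    rw [h.rowIdx_eq (by omega) (by omega), h.rowIdx_eq (by omega) (by omega)]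
    exact ⟨⟨by omega, a.2⟩, b⟩

/-- Cocharge of an evacuated tableau. -/
theorem cc_evac {n : ℕ} {T : Tab} {p : ℕ → ℕ × ℕ} (hs : StdP n p) (h : RepT n T p) :
    ccStat n (evac n T) = ∑ i ∈ DsiSet n T, i := by
  have he : RepT n (evac n T) (evP n p) := evac_rep n T p hs h
  rw [ccStat_eq he]
  apply Finset.sum_nbij' (fun j => n - j) (fun j => n - j)
  · intro j hj
    rw [mem_DsiSet he] at hj
    rw [mem_DsiSet h, ← descP_ev n p hs (n - j) (by omega) (by omega)]
    rw [show n - (n - j) = j by omega]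
    exact ⟨by omega, hj.2⟩
  · intro j hj
    rw [mem_DsiSet h] at hj
    rw [mem_DsiSet he, descP_ev n p hs j (by omega) (by omega)]
    exact ⟨by omega, hj.2⟩
  · intro j hj
    rw [mem_DsiSet he] at hj; omega
  · intro j hj
    rw [mem_DsiSet h] at hj; omega
  · intro j hj; rfl

/-! ### Robinson–Schensted -/

/-- The row of the cell added by an insertion. -/
def insRow : List (List ℕ) → ℕ → ℕ
  | [], _ => 0
  | r :: rs, x =>
    match (rowInsert x r).2 with
    | none => 0
    | some y => insRow rs y + 1

/-- Column-strictness and length comparison of two adjacent rows. -/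
def DomR : List ℕ → List ℕ → Prop
  | _, [] => True
  | [], _ :: _ => False
  | a :: r, b :: s => a < b ∧ DomR r s

/-- Semistandard lists of rows with positive entries. -/
def GoodT : List (List ℕ) → Prop
  | [] => True
  | r :: rs => r.Pairwise (· ≤ ·) ∧ (∀ a ∈ r, 0 < a) ∧ DomR r (rs.headD []) ∧ GoodT rs

theorem DomR_nil (r : List ℕ) : DomR r [] := by cases r <;> trivial

theorem DomR.len : ∀ {r s : List ℕ}, DomR r s → s.length ≤ r.length
  | _, [], _ => by simp
  | [], _ :: _, h => h.elim
  | a :: r, b :: s, h => by simpa using DomR.len h.2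

theorem rowInsert_mem (x : ℕ) : ∀ (r : List ℕ) (a : ℕ), a ∈ (rowInsert x r).1 → a = x ∨ a ∈ r
  | [], a, h => by simpa [rowInsert] using h
  | y :: ys, a, h => by
    rw [rowInsert] at h
    split_ifs at h with hxy
    · simp only [List.mem_cons] at h ⊢; tauto
    · simp only [List.mem_cons] at h ⊢
      rcases h with h | h
      · tauto
      · have := rowInsert_mem x ys a h; tauto

theorem rowInsert_some (x : ℕ) : ∀ (r : List ℕ) (y : ℕ), (rowInsert x r).2 = some y → x < y ∧ y ∈ r
  | [], y, h => by simp [rowInsert] at h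
  | a :: r, y, h => by
    rw [rowInsert] at h
    split_ifs at h with hxy
    · simp at h; subst h; simp [hxy]
    · have := rowInsert_some x r y h
      simp [this]

theorem rowInsert_sorted (x : ℕ) : ∀ (r : List ℕ), r.Pairwise (· ≤ ·) →
    (rowInsert x r).1.Pairwise (· ≤ ·)
  | [], h => by simp [rowInsert]
  | a :: r, h => by
    rw [rowInsert]
    rw [List.pairwise_cons] at h
    split_ifs with hxy
    · rw [List.pairwise_cons]
      exact ⟨fun b hb => by have := h.1 b hb; omega, h.2⟩
    · rw [List.pairwise_cons]
      refine ⟨fun b hb => ?_, rowInsert_sorted x r h.2⟩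
      rcases rowInsert_mem x r b hb with h' | h'
      · omega
      · exact h.1 b h'

theorem rowInsert_length (x : ℕ) : ∀ (r : List ℕ), (rowInsert x r).1.length =
    r.length + if (rowInsert x r).2 = none then 1 else 0
  | [] => by simp [rowInsert]
  | a :: r => by
    rw [rowInsert]
    split_ifs with h1 h2 h2
    · simp at h2
    · simp
    · have := rowInsert_length x r
      simp only at h2
      simp only [h2, if_true] at this
      simp only [List.length_cons]; omega
    · have := rowInsert_length x r
      simp only at h2
      simp only [h2, if_false] at this
      simp only [List.length_cons]; omega

theorem DomR_ins_none (x : ℕ) : ∀ (r s : List ℕ), DomR r s → (rowInsert x r).2 = none →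
    DomR (rowInsert x r).1 s
  | r, [], _, _ => DomR_nil _
  | [], _ :: _, h, _ => h.elim
  | a :: r, b :: s, h, hn => by
    rw [rowInsert] at hn ⊢
    split_ifs at hn ⊢ with h1
    exact ⟨h.1, DomR_ins_none x r s h.2 hn⟩

theorem DomR_ins_some (x y : ℕ) : ∀ (r s : List ℕ), DomR r s → (rowInsert x r).2 = some y →
    DomR (rowInsert x r).1 s
  | r, [], _, _ => DomR_nil _
  | [], _ :: _, h, _ => h.elim
  | a :: r, b :: s, h, hn => by
    rw [rowInsert] at hn ⊢
    split_ifs at hn ⊢ with h1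
    · have := h.1
      exact ⟨by omega, h.2⟩
    · exact ⟨h.1, DomR_ins_some x y r s h.2 hn⟩

theorem DomR_ins_ins (x y : ℕ) : ∀ (r s : List ℕ), DomR r s → (rowInsert x r).2 = some y →
    DomR (rowInsert x r).1 (rowInsert y s).1
  | [], _, _, h => by simp [rowInsert] at h
  | a :: r, [], _, hn => by
    have hy := rowInsert_some x _ y hn
    rw [rowInsert] at hn ⊢
    simp only [rowInsert]
    split_ifs at hn ⊢ with h1
    · exact ⟨hy.1, DomR_nil _⟩
    · exact ⟨by omega, DomR_nil _⟩
  | a :: r, b :: s, h, hn => by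
    have hy := rowInsert_some x _ y hn
    have hab := h.1
    rw [rowInsert] at hn ⊢
    simp only [rowInsert]
    by_cases h1 : x < a
    · simp only [h1, if_true] at hn ⊢
      simp only [Option.some.injEq] at hn
      subst hn
      simp only [hab, if_true]
      exact ⟨h1, h.2⟩
    · simp only [h1, if_false] at hn ⊢
      by_cases h2 : y < b
      · simp only [h2, if_true]
        exact ⟨by omega, DomR_ins_some x y r s h.2 hn⟩
      · simp only [h2, if_false]
        exact ⟨hab, DomR_ins_ins x y r s h.2 hn⟩

theorem tabInsert_none {r : List ℕ} {rs : List (List ℕ)} {x : ℕ} (h : (rowInsert x r).2 = none) :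
    tabInsert (r :: rs) x = (rowInsert x r).1 :: rs := by
  rw [tabInsert]
  split
  · next e => rw [e]
  · next e => rw [e] at h; simp at h

theorem tabInsert_some {r : List ℕ} {rs : List (List ℕ)} {x y : ℕ}
    (h : (rowInsert x r).2 = some y) :
    tabInsert (r :: rs) x = (rowInsert x r).1 :: tabInsert rs y := by
  rw [tabInsert]
  split
  · next e => rw [e] at h; simp at h
  · next e => rw [e] at h ⊢; simp at h; rw [h]

theorem insRow_none {r : List ℕ} {rs : List (List ℕ)} {x : ℕ} (h : (rowInsert x r).2 = none) :
    insRow (r :: rs) x = 0 := by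
  rw [insRow, h]

theorem insRow_some {r : List ℕ} {rs : List (List ℕ)} {x y : ℕ}
    (h : (rowInsert x r).2 = some y) : insRow (r :: rs) x = insRow rs y + 1 := by
  rw [insRow, h]

theorem tabInsert_head (rs : List (List ℕ)) (x : ℕ) :
    (tabInsert rs x).headD [] = (rowInsert x (rs.headD [])).1 := by
  cases rs with
  | nil => simp [tabInsert, rowInsert]
  | cons r rs =>
    rcases h : (rowInsert x r).2 with _ | y
    · rw [tabInsert_none h]; simp
    · rw [tabInsert_some h]; simp

theorem GoodT_insert : ∀ (t : List (List ℕ)) (x : ℕ), 0 < x → GoodT t → GoodT (tabInsert t x)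
  | [], x, hx, _ => by simp [tabInsert, GoodT, hx, DomR_nil]
  | r :: rs, x, hx, ⟨g1, g2, g3, g4⟩ => by
    have p1 := rowInsert_sorted x r g1
    have p2 : ∀ a ∈ (rowInsert x r).1, 0 < a := by
      intro a ha
      rcases rowInsert_mem x r a ha with h | h
      · omega
      · exact g2 a h
    rcases h : (rowInsert x r).2 with _ | y
    · rw [tabInsert_none h]
      exact ⟨p1, p2, DomR_ins_none x r _ g3 h, g4⟩
    · rw [tabInsert_some h]
      have hy := rowInsert_some x r y h
      refine ⟨p1, p2, ?_, GoodT_insert rs y (by omega) g4⟩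
      rw [tabInsert_head]
      exact DomR_ins_ins x y r _ g3 h

/-- Length of a row. -/
def lenT (t : List (List ℕ)) (i : ℕ) : ℕ := (t.getD i []).length

theorem lenT_insert : ∀ (t : List (List ℕ)) (x i : ℕ),
    lenT (tabInsert t x) i = lenT t i + if i = insRow t x then 1 else 0
  | [], x, i => by
    cases i <;> simp [lenT, tabInsert, insRow]
  | r :: rs, x, i => by
    have hl := rowInsert_length x r
    rcases h : (rowInsert x r).2 with _ | y
    · rw [tabInsert_none h, insRow_none h]
      cases i with
      | zero => simpa [lenT, h] using hl
      | succ i => simp [lenT]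
    · rw [tabInsert_some h, insRow_some h]
      cases i with
      | zero => simpa [lenT, h] using hl
      | succ i =>
        have := lenT_insert rs y i
        simpa [lenT] using this

theorem lenT_succ_le : ∀ (t : List (List ℕ)), GoodT t → ∀ i, lenT t (i + 1) ≤ lenT t i
  | [], _, i => by simp [lenT]
  | r :: rs, ⟨_, _, g3, g4⟩, i => by
    cases i with
    | zero =>
      have := g3.len
      cases rs <;> simpa [lenT] using this
    | succ i =>
      have := lenT_succ_le rs g4 i
      simpa [lenT] using this

theorem listEntry_ne : ∀ (t : List (List ℕ)), GoodT t → ∀ a b,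
    listEntry t (a, b) ≠ 0 ↔ b < lenT t a
  | [], _, a, b => by simp [lenT, listEntry]
  | r :: rs, ⟨_, g2, _, g4⟩, a, b => by
    cases a with
    | zero =>
      simp only [listEntry, lenT, List.getD_cons_zero]
      constructor
      · intro h
        by_contra hb
        exact h (List.getD_eq_default _ _ (by omega))
      · intro h
        rw [List.getD_eq_getElem _ _ h]
        have := g2 _ (List.getElem_mem h)
        omega
    | succ a =>
      have := listEntry_ne rs g4 a b
      simpa [lenT, listEntry] using this

theorem rowInsert_none_le (x : ℕ) : ∀ (r : List ℕ), (rowInsert x r).2 = none →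
    ∀ a ∈ r, a ≤ x
  | [], _, a, ha => by simp at ha
  | b :: r, h, a, ha => by
    rw [rowInsert] at h
    split_ifs at h with h1
    rw [List.mem_cons] at ha
    rcases ha with rfl | ha
    · omega
    · exact rowInsert_none_le x r h a ha

theorem rowInsert_none_of_le (x : ℕ) : ∀ (r : List ℕ), (∀ a ∈ r, a ≤ x) → (rowInsert x r).2 = none
  | [], _ => by simp [rowInsert]
  | b :: r, h => by
    rw [rowInsert]
    have h1 := h b (by simp)
    rw [if_neg (by omega)]
    exact rowInsert_none_of_le x r (fun a ha => h a (by simp [ha]))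

theorem rowInsert_self_mem (x : ℕ) : ∀ (r : List ℕ), x ∈ (rowInsert x r).1
  | [] => by simp [rowInsert]
  | b :: r => by
    rw [rowInsert]
    split_ifs
    · simp
    · simp [rowInsert_self_mem x r]

theorem bump_le (x y : ℕ) (hxy : x ≤ y) : ∀ (r : List ℕ), r.Pairwise (· ≤ ·) → ∀ a b,
    (rowInsert x r).2 = some a → (rowInsert y (rowInsert x r).1).2 = some b → a ≤ b
  | [], _, a, b, h, _ => by simp [rowInsert] at h
  | c :: r, hr, a, b, h1, h2 => by
    rw [List.pairwise_cons] at hr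
    rw [rowInsert] at h1 h2
    by_cases hc : x < c
    · simp only [hc, if_true] at h1 h2
      rw [rowInsert, if_neg (by omega)] at h2
      simp at h1
      subst h1
      exact hr.1 b (rowInsert_some y r b h2).2
    · simp only [hc, if_false] at h1 h2
      rw [rowInsert] at h2
      rw [if_neg (by omega)] at h2
      exact bump_le x y hxy r hr.2 a b h1 h2

theorem bump_first (y x : ℕ) : ∀ (r : List ℕ), r.Pairwise (· ≤ ·) → x ∈ r → y < x →
    ∃ b, (rowInsert y r).2 = some b ∧ b ≤ x
  | [], _, h, _ => by simp at h
  | c :: r, hr, hm, hyx => by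
    rw [List.pairwise_cons] at hr
    rw [rowInsert]
    rw [List.mem_cons] at hm
    by_cases hc : y < c
    · rw [if_pos hc]
      refine ⟨c, rfl, ?_⟩
      rcases hm with rfl | hm
      · exact le_rfl
      · exact hr.1 x hm
    · rw [if_neg hc]
      rcases hm with rfl | hm
      · omega
      · exact bump_first y x r hr.2 hm hyx

theorem insRow_le : ∀ (t : List (List ℕ)) (x y : ℕ), GoodT t → x ≤ y →
    insRow (tabInsert t x) y ≤ insRow t x
  | [], x, y, _, h => by
    rw [tabInsert, insRow_none]
    · simp
    · rw [rowInsert, if_neg (by omega)]; simp [rowInsert]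
  | r :: rs, x, y, ⟨g1, g2, g3, g4⟩, hxy => by
    rcases h : (rowInsert x r).2 with _ | a
    · rw [tabInsert_none h, insRow_none]
      · simp
      · apply rowInsert_none_of_le
        intro a ha
        rcases rowInsert_mem x r a ha with h' | h'
        · omega
        · have := rowInsert_none_le x r h a h'; omega
    · rw [tabInsert_some h, insRow_some h]
      rcases h' : (rowInsert y (rowInsert x r).1).2 with _ | b
      · rw [insRow_none h']; omega
      · rw [insRow_some h']
        have := insRow_le rs a b g4 (bump_le x y hxy r g1 a b h h')
        omega

theorem insRow_lt : ∀ (t : List (List ℕ)) (x y : ℕ), GoodT t → y < x →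
    insRow t x < insRow (tabInsert t x) y
  | [], x, y, _, h => by
    rw [tabInsert, insRow_some (y := x)]
    · simp [insRow]
    · rw [rowInsert, if_pos h]
  | r :: rs, x, y, ⟨g1, g2, g3, g4⟩, hxy => by
    obtain ⟨b, hb, hbx⟩ := bump_first y x _ (rowInsert_sorted x r g1) (rowInsert_self_mem x r) hxy
    rcases h : (rowInsert x r).2 with _ | a
    · rw [tabInsert_none h, insRow_none h, insRow_some hb]
      omega
    · rw [tabInsert_some h, insRow_some h, insRow_some hb]
      have ha := rowInsert_some x r a h
      have := insRow_lt rs a b g4 (by omega)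
      omega

theorem Ppart_succ (n : ℕ) (w : Equiv.Perm ℕ) (m : ℕ) (hm : m < n) :
    PtabListPart n w (m + 1) = tabInsert (PtabListPart n w m) (w (m + 1)) := by
  unfold PtabListPart
  rw [List.take_add_one, List.foldl_append]
  have : (oneLine n w)[m]? = some (w (m + 1)) := by
    simp [oneLine, hm]
  rw [this]
  simp

theorem Ppart_ge (n : ℕ) (w : Equiv.Perm ℕ) (m : ℕ) (hm : n ≤ m) :
    PtabListPart n w m = PtabListPart n w n := by
  unfold PtabListPart
  have : (oneLine n w).length = n := by simp [oneLine]
  rw [List.take_of_length_le (by omega), List.take_of_length_le (by omega)]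

theorem perm_pos {n : ℕ} {w : Equiv.Perm ℕ} (hw : SuppIn n w) (i : ℕ) : 0 < w (i + 1) := by
  rcases Nat.eq_zero_or_pos (w (i + 1)) with h | h
  · have h0 := hw 0 (Or.inl rfl)
    have := w.injective (h.trans h0.symm)
    omega
  · exact h

theorem Ppart_good {n : ℕ} {w : Equiv.Perm ℕ} (hw : SuppIn n w) (m : ℕ) (hm : m ≤ n) :
    GoodT (PtabListPart n w m) := by
  induction m with
  | zero => simp [PtabListPart, GoodT]
  | succ m ih =>
    rw [Ppart_succ n w m (by omega)]
    exact GoodT_insert _ _ (perm_pos hw m) (ih (by omega))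

/-- The growth sequence of the recording tableau. -/
def recP (n : ℕ) (w : Equiv.Perm ℕ) (m : ℕ) : ℕ × ℕ :=
  (insRow (PtabListPart n w (m - 1)) (w m),
    lenT (PtabListPart n w (m - 1)) (insRow (PtabListPart n w (m - 1)) (w m)))

theorem cells_recP {n : ℕ} {w : Equiv.Perm ℕ} (m : ℕ) (hm : m ≤ n) (a b : ℕ) :
    (a, b) ∈ cellsP (recP n w) m ↔ b < lenT (PtabListPart n w m) a := by
  induction m with
  | zero => simp [cellsP_zero, PtabListPart, lenT]
  | succ m ih =>
    rw [cellsP_succ, ih (by omega), Ppart_succ n w m (by omega), lenT_insert]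
    simp only [recP, Nat.add_sub_cancel, Prod.mk.injEq]
    split_ifs with h
    · subst h; simp only [true_and]; omega
    · simp [h]

theorem recP_std {n : ℕ} {w : Equiv.Perm ℕ} (hw : SuppIn n w) : StdP n (recP n w) := by
  constructor
  · intro j hj
    rw [recP, cells_recP j (by omega)]
    simp
  · intro j hj a b c d hab hc hd
    rw [cells_recP j hj] at hab ⊢
    have hanti : Antitone (lenT (PtabListPart n w j)) :=
      antitone_nat_of_succ_le (lenT_succ_le _ (Ppart_good hw j hj))
    have := hanti hc
    omega

theorem recP_rep {n : ℕ} {w : Equiv.Perm ℕ} (hw : SuppIn n w) : RepT n (Qtab n w) (recP n w) := by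
  have key : ∀ m, m ≤ n → ∀ x, listEntry (PtabListPart n w m) x ≠ 0 ↔
      x ∈ cellsP (recP n w) m := by
    rintro m hm ⟨a, b⟩
    rw [listEntry_ne _ (Ppart_good hw m hm), cells_recP m hm]
  constructor
  · intro i h1 h2
    apply le_antisymm
    · apply Nat.sInf_le
      exact (key i h2 _).2 ⟨i, h1, le_rfl, rfl⟩
    · apply le_csInf
      · exact ⟨i, (key i h2 _).2 ⟨i, h1, le_rfl, rfl⟩⟩
      · intro m hm
        by_contra hlt
        exact (recP_std hw).notin_lt (show m < i by omega) h2 ((key m (by omega) _).1 hm)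
  · intro x hx
    have hne : {m | listEntry (PtabListPart n w m) x ≠ 0}.Nonempty := by
      rw [Set.nonempty_iff_ne_empty]
      intro e
      apply hx
      rw [Qtab, e, Nat.sInf_empty]
    obtain ⟨m, hm⟩ := hne
    by_cases hmn : m ≤ n
    · obtain ⟨i, a, b, c⟩ := (key m hmn x).1 hm
      exact ⟨i, a, by omega, c⟩
    · rw [Set.mem_setOf_eq, Ppart_ge n w m (by omega)] at hm
      exact (key n le_rfl x).1 hm

theorem Dsi_Q {n : ℕ} {w : Equiv.Perm ℕ} (hw : SuppIn n w) : DsiSet n (Qtab n w) = DslSet n w := by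
  ext i
  rw [mem_DsiSet (recP_rep hw)]
  simp only [DslSet, Finset.mem_filter, Finset.mem_Ioo]
  constructor
  · rintro ⟨a, b⟩
    refine ⟨⟨by omega, a.2⟩, ?_⟩
    by_contra hlt
    obtain ⟨m, rfl⟩ : ∃ m, i = m + 1 := ⟨i - 1, by omega⟩
    have := insRow_le _ (w (m + 1)) (w (m + 1 + 1)) (Ppart_good hw m (by omega)) (by omega)
    simp only [descP, recP, Nat.add_sub_cancel] at b
    rw [Ppart_succ n w m (by omega)] at b
    omega
  · rintro ⟨a, b⟩
    refine ⟨⟨by omega, a.2⟩, ?_⟩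
    obtain ⟨m, rfl⟩ : ∃ m, i = m + 1 := ⟨i - 1, by omega⟩
    have := insRow_lt _ (w (m + 1)) (w (m + 1 + 1)) (Ppart_good hw m (by omega)) b
    simp only [descP, recP, Nat.add_sub_cancel]
    rw [Ppart_succ n w m (by omega)]
    exact this

theorem cc_Qt {n : ℕ} {w : Equiv.Perm ℕ} (hw : SuppIn n w) :
    ccStat n (Qt n w) = ∑ i ∈ DslSet n w, i := by
  rw [Qt, cc_evac (recP_std hw) (recP_rep hw), Dsi_Q hw]

theorem Dsl_succ {n : ℕ} {w : Equiv.Perm ℕ} (hw : SuppIn n w) :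
    DslSet (n + 1) w = DslSet n w := by
  ext i
  simp only [DslSet, Finset.mem_filter, Finset.mem_Ioo]
  constructor
  · rintro ⟨a, b⟩
    refine ⟨⟨a.1, ?_⟩, b⟩
    by_contra hlt
    have hi : i = n := by omega
    subst hi
    have h1 := hw (i + 1) (Or.inr (by omega))
    have h2 := hw (w i) (Or.inr (by omega))
    have := w.injective h2
    omega
  · rintro ⟨a, b⟩
    exact ⟨⟨a.1, by omega⟩, b⟩

/-- For every `w ∈ Sₙ`, `cc(Q̃(w)) = Σ_{i ∈ Dsl(w)} i` (the major index of
`w`); moreover `Dsl(w₊) = Dsl(w)` for `w₊ ∈ S_{n+1}` acting as `w` on `{1,…,n}` and fixing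
`n+1` (here `w₊` is the same permutation of `ℕ`), whence `cc(Q̃(w₊)) = cc(Q̃(w))`. -/
theorem statement_8 (n : ℕ) (w : Equiv.Perm ℕ) (hw : SuppIn n w) :
    ccStat n (Qt n w) = ∑ i ∈ DslSet n w, i ∧
    DslSet (n + 1) w = DslSet n w ∧
    ccStat (n + 1) (Qt (n + 1) w) = ccStat n (Qt n w) := by
  have hw' : SuppIn (n + 1) w := fun i hi => hw i (by omega)
  refine ⟨cc_Qt hw, Dsl_succ hw, ?_⟩
  rw [cc_Qt hw', cc_Qt hw, Dsl_succ hw]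

end HigherSpecht
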